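/- arXiv:2511.18006 — 2 statements merged into one kernel-verified Lean document; each statement's English description precedes it below -/
import Mathlib

section
/- Let Γ_{j,r}^{(t)}, Φ_{j,r,i}^{(t)} be the unique signal–noise decomposition coefficients of the noisy gradient descent iterates, and set Φ̄_{j,r,i}^{(t)} = Φ_{j,r,i}^{(t)}·1(Φ_{j,r,i}^{(t)} ≥ 0), Φ̲_{j,r,i}^{(t)} = Φ_{j,r,i}^{(t)}·1(Φ_{j,r,i}^{(t)} ≤ 0). Then the coefficients satisfy: Γ_{j,r}^{(0)} = Φ̄_{j,r,i}^{(0)} = Φ̲_{j,r,i}^{(0)} = 0; Γ_{j,r}^{(t+1)} = Γ_{j,r}^{(t)} − (η/(nm))·Σ_{i=1}^n ℓ_i′^{(t)}·σ′(⟨w_{j,r}^{(t)}, y_i·v⟩)·‖v‖₂²; Φ̄_{j,r,i}^{(t+1)} = Φ̄_{j,r,i}^{(t)} − (η/(nm))·ℓ_i′^{(t)}·σ′(⟨w_{j,r}^{(t)}, ξ_i⟩)·‖ξ_i‖₂²·1(y_i = j); and Φ̲_{j,r,i}^{(t+1)} = Φ̲_{j,r,i}^{(t)} + (η/(nm))·ℓ_i′^{(t)}·σ′(⟨w_{j,r}^{(t)},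 ξ_i⟩)·‖ξ_i‖₂²·1(y_i = −j). In particular, since ℓ_i′^{(t)} < 0, Γ_{j,r}^{(t)} and Φ̄_{j,r,i}^{(t)} are nondecreasing in t and Φ̲_{j,r,i}^{(t)} is nonincreasing in t. -/
open MeasureTheory ProbabilityTheory Finset
open scoped RealInnerProductSpace BigOperators ENNReal NNReal

noncomputable section

/-- Euclidean space ℝ^d. -/
abbrev EV (d : ℕ) : Type := EuclideanSpace ℝ (Fin d)

/-- Polynomial ReLU activation σ(z) = max(0,z)^q. -/
def pReLU (q : ℕ) (z : ℝ) : ℝ := (max 0 z) ^ q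

/-- Derivative σ'(z) = q·max(0,z)^(q-1). -/
def pReLU' (q : ℕ) (z : ℝ) : ℝ := q * (max 0 z) ^ (q - 1)

/-- Sign associated to a filter-group index: j = 0 ↦ +1, j = 1 ↦ -1. -/
def jsgn (j : Fin 2) : ℝ := if j = 0 then 1 else -1

/-- Output F_j of group j of the two-layer CNN on the two-patch input (x1, x2). -/
def Fout {d : ℕ} (q m : ℕ) (W : Fin 2 → Fin m → EV d) (j : Fin 2) (x1 x2 : EV d) : ℝ :=
  (m : ℝ)⁻¹ * ∑ r : Fin m, (pReLU q ⟪W j r, x1⟫ + pReLU q ⟪W j r, x2⟫)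

/-- CNN output f(W,x) = F₊(W₊,x) − F₋(W₋,x). -/
def fnet {d : ℕ} (q m : ℕ) (W : Fin 2 → Fin m → EV d) (x1 x2 : EV d) : ℝ :=
  Fout q m W 0 x1 x2 - Fout q m W 1 x1 x2

/-- Logistic loss ℓ(z) = log(1+exp(−z)). -/
def logloss (z : ℝ) : ℝ := Real.log (1 + Real.exp (-z))

/-- Its derivative ℓ'(z) = −1/(1+exp z). -/
def logloss' (z : ℝ) : ℝ := -(1 / (1 + Real.exp z))

/-- Empirical logistic loss on the training data x_i = [y_i • v, ξ_i]. -/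
def empLoss {d : ℕ} (q m n : ℕ) (y : Fin n → ℝ) (v : EV d) (ξ : Fin n → EV d)
    (W : Fin 2 → Fin m → EV d) : ℝ :=
  (n : ℝ)⁻¹ * ∑ i : Fin n, logloss (y i * fnet q m W (y i • v) (ξ i))

/-- Gradient of the empirical loss with respect to filter w_{j,r}. -/
def gradFilter {d : ℕ} (q m n : ℕ) (y : Fin n → ℝ) (v : EV d) (ξ : Fin n → EV d)
    (W : Fin 2 → Fin m → EV d) (j : Fin 2) (r : Fin m) : EV d :=
  ((n : ℝ) * (m : ℝ))⁻¹ •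
    ((∑ i : Fin n, (logloss' (y i * fnet q m W (y i • v) (ξ i)) *
        pReLU' q ⟪W j r, ξ i⟫ * (jsgn j * y i)) • ξ i)
    + (∑ i : Fin n, (logloss' (y i * fnet q m W (y i • v) (ξ i)) *
        pReLU' q ⟪W j r, y i • v⟫ * jsgn j) • v))

/-- Gradient of the network output f(W, x) with respect to filter w_{j,r}. -/
def gradfFilter {d : ℕ} (q m : ℕ) (W : Fin 2 → Fin m → EV d) (x1 x2 : EV d)
    (j : Fin 2) (r : Fin m) : EV d :=
  ((m : ℝ)⁻¹ * jsgn j) • (pReLU' q ⟪W j r, x1⟫ • x1 + pReLU' q ⟪W j r, x2⟫ • x2)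

/-- Frobenius inner product of two weight configurations. -/
def frobInner {d m : ℕ} (A B : Fin 2 → Fin m → EV d) : ℝ :=
  ∑ j : Fin 2, ∑ r : Fin m, ⟪A j r, B j r⟫

/-- Squared Frobenius norm of a weight configuration. -/
def frobSq {d m : ℕ} (A : Fin 2 → Fin m → EV d) : ℝ :=
  ∑ j : Fin 2, ∑ r : Fin m, ‖A j r‖ ^ 2

/-- A random vector `g` is centered Gaussian with covariance quadratic form `Q`:
every one-dimensional projection ⟪g, u⟫ has law N(0, Q u). -/
def IsGaussianVec {Ω : Type*} [MeasureSpace Ω] {d : ℕ} (g : Ω → EV d) (Q : EV d → ℝ) : Prop :=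
  Measurable g ∧ ∀ u : EV d,
    Measure.map (fun ω => ⟪g ω, u⟫) (ℙ : Measure Ω) =
      ProbabilityTheory.gaussianReal 0 (Real.toNNReal (Q u))

/-- The coefficients of a vanishing combination of a linearly independent family headed by `v`
are zero. -/
lemma coeffs_eq_zero_of_linearIndependent_vecCons {E : Type*} [AddCommGroup E] [Module ℝ E]
    {n : ℕ} {v : E} {ξ : Fin n → E} (h : LinearIndependent ℝ (Matrix.vecCons v ξ))
    {a : ℝ} {c : Fin n → ℝ} (hs : a • v + ∑ i, c i • ξ i = 0) : a = 0 ∧ ∀ i, c i = 0 := by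
  have key := Fintype.linearIndependent_iff.1 h (Matrix.vecCons a c)
    (by simpa [Fin.sum_univ_succ] using hs)
  exact ⟨by simpa using key 0, fun i => by simpa using key i.succ⟩

lemma logloss'_neg (x : ℝ) : logloss' x < 0 := by
  unfold logloss'
  have := Real.exp_pos x
  exact neg_neg_of_pos (by positivity)

lemma pReLU'_nonneg (q : ℕ) (x : ℝ) : 0 ≤ pReLU' q x := by
  unfold pReLU'
  have : 0 ≤ max 0 x := le_max_left _ _
  positivity

lemma jsgn_eq_one_or (j : Fin 2) : jsgn j = 1 ∨ jsgn j = -1 := by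
  unfold jsgn
  split_ifs <;> simp

lemma jsgn_mul_self (j : Fin 2) : jsgn j * jsgn j = 1 := by
  rcases jsgn_eq_one_or j with h | h <;> simp [h]

/-- The signal–noise decomposition coefficients of the noisy gradient
descent iterates start from zero and obey the stated recurrences; since `ℓ' < 0`,
`Γ_{j,r}^{(t)}` and `Φ̄_{j,r,i}^{(t)} = max(Φ,0)` are nondecreasing in `t` while
`Φ̲_{j,r,i}^{(t)} = min(Φ,0)` is nonincreasing in `t`. -/
theorem statement3
    (d q m n : ℕ) (hq : 2 < q) (hm : 0 < m) (hn : 0 < n)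
    (η : ℝ) (hη : 0 < η)
    (v : EV d) (ξ : Fin n → EV d) (y : Fin n → ℝ)
    (hy : ∀ i, y i = 1 ∨ y i = -1)
    (z : ℕ → EV d) (W : ℕ → Fin 2 → Fin m → EV d)
    (hlin : LinearIndependent ℝ (Matrix.vecCons v ξ))
    (hstep : ∀ (t : ℕ) (j : Fin 2) (r : Fin m),
      W (t + 1) j r = W t j r - η • (gradFilter q m n y v ξ (W t) j r + z (t + 1)))
    (Γ : ℕ → Fin 2 → Fin m → ℝ) (Φ : ℕ → Fin 2 → Fin m → Fin n → ℝ)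
    (hdecomp : ∀ (t : ℕ) (j : Fin 2) (r : Fin m),
      W t j r = W 0 j r + ((jsgn j * Γ t j r) / ‖v‖ ^ 2) • v
        + ∑ i : Fin n, (Φ t j r i / ‖ξ i‖ ^ 2) • ξ i
        - η • ∑ s ∈ Finset.Icc 1 t, z s) :
    (∀ j r, Γ 0 j r = 0) ∧
    (∀ j r i, max (Φ 0 j r i) 0 = 0 ∧ min (Φ 0 j r i) 0 = 0) ∧
    (∀ t j r, Γ (t + 1) j r = Γ t j r
      - η / (n * m) * ∑ i : Fin n,
          logloss' (y i * fnet q m (W t) (y i • v) (ξ i)) *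
            pReLU' q ⟪W t j r, y i • v⟫ * ‖v‖ ^ 2) ∧
    (∀ t j r i, max (Φ (t + 1) j r i) 0 = max (Φ t j r i) 0
      - η / (n * m) * (logloss' (y i * fnet q m (W t) (y i • v) (ξ i)) *
          pReLU' q ⟪W t j r, ξ i⟫ * ‖ξ i‖ ^ 2) * (if y i = jsgn j then 1 else 0)) ∧
    (∀ t j r i, min (Φ (t + 1) j r i) 0 = min (Φ t j r i) 0
      + η / (n * m) * (logloss' (y i * fnet q m (W t) (y i • v) (ξ i)) *
          pReLU' q ⟪W t j r, ξ i⟫ * ‖ξ i‖ ^ 2) * (if y i = -(jsgn j) then 1 else 0)) ∧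
    (∀ j r, Monotone fun t => Γ t j r) ∧
    (∀ j r i, Monotone fun t => max (Φ t j r i) 0) ∧
    (∀ j r i, Antitone fun t => min (Φ t j r i) 0) := by
  have hv : ‖v‖ ^ 2 ≠ 0 := by
    have : v ≠ 0 := by simpa using hlin.ne_zero 0
    simpa using this
  have hξ : ∀ i, ‖ξ i‖ ^ 2 ≠ 0 := fun i => by
    have : ξ i ≠ 0 := by simpa using hlin.ne_zero i.succ
    simpa using this
  have hj : ∀ j, jsgn j ≠ 0 := fun j => left_ne_zero_of_mul_eq_one (jsgn_mul_self j)
  have h0 : ∀ j r, Γ 0 j r = 0 ∧ ∀ i, Φ 0 j r i = 0 := by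
    intro j r
    have h := hdecomp 0 j r
    have hs : ((jsgn j * Γ 0 j r) / ‖v‖ ^ 2) • v + ∑ i, (Φ 0 j r i / ‖ξ i‖ ^ 2) • ξ i = 0 := by
      simpa [add_assoc] using h
    obtain ⟨ha, hc⟩ := coeffs_eq_zero_of_linearIndependent_vecCons hlin hs
    refine ⟨?_, fun i => ?_⟩
    · simpa [hv, hj j] using (div_eq_zero_iff.1 ha).resolve_right hv
    · exact (div_eq_zero_iff.1 (hc i)).resolve_right (hξ i)
  have hrec : ∀ t j r,
      Γ (t + 1) j r = Γ t j r - η / (n * m) * ∑ i : Fin n,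
          logloss' (y i * fnet q m (W t) (y i • v) (ξ i)) *
            pReLU' q ⟪W t j r, y i • v⟫ * ‖v‖ ^ 2 ∧
      ∀ i, Φ (t + 1) j r i = Φ t j r i
        - η / (n * m) * (logloss' (y i * fnet q m (W t) (y i • v) (ξ i)) *
          pReLU' q ⟪W t j r, ξ i⟫ * ‖ξ i‖ ^ 2) * (jsgn j * y i) := by
    intro t j r
    have h := hstep t j r
    rw [hdecomp (t + 1) j r, hdecomp t j r, Finset.sum_Icc_succ_top (by omega), gradFilter] at h
    set A : Fin n → ℝ := fun i => logloss' (y i * fnet q m (W t) (y i • v) (ξ i)) *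
        pReLU' q ⟪W t j r, ξ i⟫ * (jsgn j * y i) with hA
    set B : Fin n → ℝ := fun i => logloss' (y i * fnet q m (W t) (y i • v) (ξ i)) *
        pReLU' q ⟪W t j r, y i • v⟫ with hB
    have hs : ((jsgn j * Γ (t + 1) j r) / ‖v‖ ^ 2 - (jsgn j * Γ t j r) / ‖v‖ ^ 2
          + η * ((n : ℝ) * m)⁻¹ * ∑ i, B i * jsgn j) • v
        + ∑ i, (Φ (t + 1) j r i / ‖ξ i‖ ^ 2 - Φ t j r i / ‖ξ i‖ ^ 2
          + η * ((n : ℝ) * m)⁻¹ * A i) • ξ i = 0 := by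
      simp only [add_smul, sub_smul, mul_smul, Finset.sum_add_distrib, Finset.sum_sub_distrib,
        ← Finset.smul_sum, Finset.sum_smul] at h ⊢
      rw [← sub_eq_zero] at h
      rw [← h]
      simp only [hA, hB, mul_smul, smul_add]
      abel
    obtain ⟨ha, hc⟩ := coeffs_eq_zero_of_linearIndependent_vecCons hlin hs
    refine ⟨?_, fun i => ?_⟩
    · have hv' : ‖v‖ ≠ 0 := ne_zero_pow two_ne_zero hv
      apply mul_left_cancel₀ (hj j)
      rw [← Finset.sum_mul] at ha ⊢
      field_simp at ha ⊢
      linear_combination ha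
    · have hci := hc i
      have hξ' : ‖ξ i‖ ≠ 0 := ne_zero_pow two_ne_zero (hξ i)
      simp only [hA] at hci
      field_simp at hci ⊢
      linear_combination hci
  set P : ℕ → Fin 2 → Fin m → Fin n → ℝ := fun t j r i =>
    η / (n * m) * (logloss' (y i * fnet q m (W t) (y i • v) (ξ i)) *
      pReLU' q ⟪W t j r, ξ i⟫ * ‖ξ i‖ ^ 2) with hP
  have hP_nonpos : ∀ t j r i, P t j r i ≤ 0 := fun t j r i =>
    mul_nonpos_of_nonneg_of_nonpos (by positivity) <|
      mul_nonpos_of_nonpos_of_nonneg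
        (mul_nonpos_of_nonpos_of_nonneg (logloss'_neg _).le (pReLU'_nonneg _ _)) (by positivity)
  have hΦ : ∀ t j r i, Φ (t + 1) j r i = Φ t j r i - P t j r i * (jsgn j * y i) :=
    fun t j r i => (hrec t j r).2 i
  have hcases : ∀ j i, y i = jsgn j ∨ y i = -jsgn j := by
    intro j i
    rcases hy i with h | h <;> rcases jsgn_eq_one_or j with h' | h' <;> simp [h, h']
  have hne : ∀ j, jsgn j ≠ -jsgn j := fun j h => hj j (self_eq_neg.1 h)
  have hpos : ∀ j r i, y i = jsgn j → ∀ t, 0 ≤ Φ t j r i := by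
    intro j r i h t
    induction t with
    | zero => exact ((h0 j r).2 i).ge
    | succ t ih =>
      rw [hΦ, h, jsgn_mul_self]
      linarith [hP_nonpos t j r i]
  have hneg : ∀ j r i, y i = -jsgn j → ∀ t, Φ t j r i ≤ 0 := by
    intro j r i h t
    induction t with
    | zero => exact ((h0 j r).2 i).le
    | succ t ih =>
      rw [hΦ, h, mul_neg, jsgn_mul_self]
      linarith [hP_nonpos t j r i]
  have hmax : ∀ t j r i, max (Φ (t + 1) j r i) 0 = max (Φ t j r i) 0
      - P t j r i * (if y i = jsgn j then 1 else 0) := by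
    intro t j r i
    rcases hcases j i with h | h
    · rw [max_eq_left (hpos j r i h _), max_eq_left (hpos j r i h _), hΦ, if_pos h, h,
        jsgn_mul_self]
    · rw [max_eq_right (hneg j r i h _), max_eq_right (hneg j r i h _),
        if_neg (h ▸ (hne j).symm)]
      simp
  have hmin : ∀ t j r i, min (Φ (t + 1) j r i) 0 = min (Φ t j r i) 0
      + P t j r i * (if y i = -(jsgn j) then 1 else 0) := by
    intro t j r i
    rcases hcases j i with h | h
    · rw [min_eq_right (hpos j r i h _), min_eq_right (hpos j r i h _), if_neg (h ▸ hne j)]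
      simp
    · rw [min_eq_left (hneg j r i h _), min_eq_left (hneg j r i h _), hΦ, if_pos h, h,
        mul_neg, jsgn_mul_self]
      ring
  refine ⟨fun j r => (h0 j r).1, fun j r i => by simp [(h0 j r).2 i],
    fun t j r => (hrec t j r).1, hmax, hmin, fun j r => monotone_nat_of_le_succ fun t => ?_,
    fun j r i => monotone_nat_of_le_succ fun t => ?_,
    fun j r i => antitone_nat_of_succ_le fun t => ?_⟩
  · rw [(hrec t j r).1]
    have : η / (n * m) * ∑ i : Fin n, logloss' (y i * fnet q m (W t) (y i • v) (ξ i)) *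
        pReLU' q ⟪W t j r, y i • v⟫ * ‖v‖ ^ 2 ≤ 0 :=
      mul_nonpos_of_nonneg_of_nonpos (by positivity) <| Finset.sum_nonpos fun i _ =>
        mul_nonpos_of_nonpos_of_nonneg
          (mul_nonpos_of_nonpos_of_nonneg (logloss'_neg _).le (pReLU'_nonneg _ _)) (by positivity)
    linarith
  · rw [hmax]
    split_ifs <;> linarith [hP_nonpos t j r i]
  · rw [hmin]
    split_ifs <;> linarith [hP_nonpos t j r i]
end
end

section
/- Under the parameter choices (step size, dimension, and the bound 4·max{β, 8n√(log(4n²/δ)/d)·α, η·C·T_p*·μ·log(1/δ)·(‖v‖₂+‖ξ‖₂)/(mnε)} ≤ 1), suppose the coefficient bounds of the key proposition hold at iteration t. Then for all r ∈ [m] and all i with j ≠ y_i: (i) ⟨w_{j,r}^{(t)}, y_i·v⟩ ≤ ⟨w_{j,r}^{(0)}, y_i·v⟩ − η Σ_{s=1}^t ⟨z_s, y_i·v⟩; (ii) ⟨w_{j,r}^{(t)}, ξ_i⟩ ≤ ⟨w_{j,r}^{(0)}, ξ_i⟩ + 8n√(log(4n²/δ)/d)·α − η Σ_{s=1}^t ⟨z_s,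 ξ_i⟩; and (iii) F_j(W_j^{(t)}, x_i) ≤ 1. -/
open MeasureTheory ProbabilityTheory Finset
open scoped RealInnerProductSpace BigOperators ENNReal NNReal

noncomputable section

/-- On `(-∞, b]` with `0 ≤ b ≤ 1`, the activation of degree at least three is at most `b ^ 3`. -/
lemma pReLU_le_cube {q : ℕ} (hq : 2 < q) {x b : ℝ} (hb0 : 0 ≤ b) (hb1 : b ≤ 1) (hx : x ≤ b) :
    pReLU q x ≤ b ^ 3 :=
  (pow_le_pow_left₀ (le_max_left _ _) (max_le hb0 hx) q).trans
    (pow_le_pow_of_le_one hb0 hb1 hq)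

/-- The network output is at most one when every filter's patch responses are small. -/
lemma Fout_le_one {d q m : ℕ} (hq : 2 < q) (hm : 0 < m) (W : Fin 2 → Fin m → EV d) (j : Fin 2)
    (x₁ x₂ : EV d) (h₁ : ∀ r, ⟪W j r, x₁⟫ ≤ 3 / 8) (h₂ : ∀ r, ⟪W j r, x₂⟫ ≤ 5 / 8) :
    Fout q m W j x₁ x₂ ≤ 1 := by
  have hm' : (0 : ℝ) < m := Nat.cast_pos.mpr hm
  have hsum : ∑ r : Fin m, (pReLU q ⟪W j r, x₁⟫ + pReLU q ⟪W j r, x₂⟫) ≤ m := by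
    calc _ ≤ ∑ _r : Fin m, (1 : ℝ) := Finset.sum_le_sum fun r _ => by
          have a := pReLU_le_cube hq (by norm_num) (by norm_num) (h₁ r)
          have b := pReLU_le_cube hq (by norm_num) (by norm_num) (h₂ r)
          norm_num at a b
          linarith
      _ = m := by simp
  unfold Fout
  rw [inv_mul_le_iff₀ hm', mul_one]
  exact hsum

/-- A label that differs from the group sign is its negative. -/
lemma mul_jsgn_of_ne {y : ℝ} (hy : y = 1 ∨ y = -1) {j : Fin 2} (hj : y ≠ jsgn j) :
    y * jsgn j = -1 := by
  unfold jsgn at *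
  split_ifs at * <;> rcases hy with rfl | rfl <;> simp_all

/-- The cross-correlation bound, normalised by the squared norm of the noise patch. -/
lemma cross_div_norm_sq_le {σξ D L N c : ℝ} (hσ : 0 < σξ) (hD : 0 < D)
    (hN : σξ ^ 2 * D / 2 ≤ N) (hc : |c| ≤ 2 * σξ ^ 2 * √(D * L)) :
    |c| / N ≤ 4 * √(L / D) := by
  have hN0 : 0 < σξ ^ 2 * D / 2 := by positivity
  have hs : √(D * L) = D * √(L / D) := by
    rw [show D * L = D ^ 2 * (L / D) by field_simp, Real.sqrt_mul (by positivity),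
      Real.sqrt_sq hD.le]
  rw [div_le_iff₀ (hN0.trans_le hN)]
  calc |c| ≤ 4 * √(L / D) * (σξ ^ 2 * D / 2) := by rw [hs] at hc; linarith
    _ ≤ 4 * √(L / D) * N := by gcongr

/-- Each entry of a finite triple-indexed family is at most its iterated supremum. -/
lemma le_iSup₃_of_finite {ι κ τ : Type*} [Finite ι] [Finite κ] [Finite τ]
    (f : ι → κ → τ → ℝ) (a : ι) (b : κ) (c : τ) : f a b c ≤ ⨆ (i) (j) (k), f i j k :=
  (le_ciSup (Set.finite_range _).bddAbove c).trans <|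
    (le_ciSup (f := fun j => ⨆ k, f a j k) (Set.finite_range _).bddAbove b).trans <|
      le_ciSup (f := fun i => ⨆ (j) (k), f i j k) (Set.finite_range _).bddAbove a

/-- A combination of vectors, tested against the vector `x i`, is bounded by its off-diagonal
correlations when the coefficient at `i` is nonpositive. -/
lemma sum_div_mul_inner_le {d n : ℕ} (x : Fin n → EV d) (i : Fin n) (c : Fin n → ℝ) {α K : ℝ}
    (hα : 0 ≤ α) (hK : 0 ≤ K) (hc : ∀ k, |c k| ≤ α) (hci : c i ≤ 0)
    (hx : ∀ k, k ≠ i → |⟪x k, x i⟫| / ‖x k‖ ^ 2 ≤ K) :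
    ∑ k, c k / ‖x k‖ ^ 2 * ⟪x k, x i⟫ ≤ n * K * α := by
  calc _ ≤ ∑ _k : Fin n, K * α := Finset.sum_le_sum fun k _ => by
        by_cases hk : k = i
        · subst hk
          rw [real_inner_self_eq_norm_sq]
          exact (mul_nonpos_of_nonpos_of_nonneg (div_nonpos_of_nonpos_of_nonneg hci
            (by positivity)) (by positivity)).trans (by positivity)
        · calc _ ≤ |c k / ‖x k‖ ^ 2 * ⟪x k, x i⟫| := le_abs_self _
            _ = |⟪x k, x i⟫| / ‖x k‖ ^ 2 * |c k| := by
              rw [abs_mul, abs_div, abs_of_nonneg (by positivity : 0 ≤ ‖x k‖ ^ 2)]; ring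
            _ ≤ K * α := mul_le_mul (hx k hk) (hc k) (abs_nonneg _) hK
    _ = n * K * α := by simp [mul_assoc]

/-- **Lemma C.5 / lem:jneqy_F_1.** Under the parameter choices and the
coefficient bounds of the key proposition at iteration `t`, for every filter `r` and every
sample `i` whose label disagrees with the group sign (`y_i ≠ j`):
(i) `⟨w_{j,r}^{(t)}, y_i v⟩ ≤ ⟨w_{j,r}^{(0)}, y_i v⟩ − η Σ_s ⟨z_s, y_i v⟩`;
(ii) `⟨w_{j,r}^{(t)}, ξ_i⟩ ≤ ⟨w_{j,r}^{(0)}, ξ_i⟩ + 8n√(log(4n²/δ)/d)·α − η Σ_s ⟨z_s, ξ_i⟩`;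
(iii) `F_j(W_j^{(t)}, x_i) ≤ 1`. -/
theorem statement8
    (d q m n : ℕ) (hq : 2 < q) (hd : 0 < d) (hm : 0 < m) (hn : 0 < n)
    (η α δ σξ C Tp μ ε nrmξ : ℝ)
    (hη : 0 < η) (hδ0 : 0 < δ) (hδ1 : δ < 1) (hσξ : 0 < σξ) (hα : 0 ≤ α)
    (hC : 0 < C) (hTp : 0 < Tp) (hμ : 1 ≤ μ) (hε : 0 < ε) (hnξ : 0 < nrmξ)
    (v : EV d) (hv : v ≠ 0) (ξ : Fin n → EV d) (y : Fin n → ℝ)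
    (hy : ∀ i, y i = 1 ∨ y i = -1)
    (horth : ∀ i, ⟪ξ i, v⟫ = 0)
    (z : ℕ → EV d) (W : ℕ → Fin 2 → Fin m → EV d) (t : ℕ)
    (Γ : Fin 2 → Fin m → ℝ) (Φb Φu : Fin 2 → Fin m → Fin n → ℝ)
    (hΦb : ∀ j r i, 0 ≤ Φb j r i ∧ (y i ≠ jsgn j → Φb j r i = 0))
    (hΦu : ∀ j r i, Φu j r i ≤ 0 ∧ (y i ≠ -jsgn j → Φu j r i = 0))
    (hΓα : ∀ j r, 0 ≤ Γ j r ∧ Γ j r ≤ α)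
    (hΦbα : ∀ j r i, Φb j r i ≤ α)
    (hΦuα : ∀ j r i, -α ≤ Φu j r i)
    (hnorm : ∀ i, σξ ^ 2 * d / 2 ≤ ‖ξ i‖ ^ 2)
    (hcross : ∀ i i', i ≠ i' →
      |⟪ξ i', ξ i⟫| ≤ 2 * σξ ^ 2 * Real.sqrt (d * Real.log (4 * n ^ 2 / δ)))
    (hdecomp : ∀ j r, W t j r = W 0 j r + ((jsgn j * Γ j r) / ‖v‖ ^ 2) • v
        + ∑ i : Fin n, ((Φb j r i + Φu j r i) / ‖ξ i‖ ^ 2) • ξ i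
        - η • ∑ s ∈ Finset.Icc 1 t, z s)
    -- accumulated private-noise bounds (good event of Lemma 4.2):
    (hzv : |η * ∑ s ∈ Finset.Icc 1 t, ⟪z s, v⟫|
      ≤ η * C * Tp * μ * Real.log (1 / δ) * (‖v‖ + nrmξ) / (m * n * ε))
    (hzξ : ∀ i, |η * ∑ s ∈ Finset.Icc 1 t, ⟪z s, ξ i⟫|
      ≤ η * C * Tp * μ * Real.log (1 / δ) * (‖v‖ + nrmξ) / (m * n * ε))
    -- the parameter-choice smallness condition (eq. beta_alpha):
    (hsmall :
      4 * max
        (2 * ⨆ (j : Fin 2) (r : Fin m) (i : Fin n),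
            max |⟪W 0 j r, v⟫| |⟪W 0 j r, ξ i⟫|)
        (max (8 * n * Real.sqrt (Real.log (4 * n ^ 2 / δ) / d) * α)
          (η * C * Tp * μ * Real.log (1 / δ) * (‖v‖ + nrmξ) / (m * n * ε))) ≤ 1) :
    ∀ (j : Fin 2) (r : Fin m) (i : Fin n), y i ≠ jsgn j →
      (⟪W t j r, y i • v⟫
          ≤ ⟪W 0 j r, y i • v⟫ - η * ∑ s ∈ Finset.Icc 1 t, ⟪z s, y i • v⟫) ∧
      (⟪W t j r, ξ i⟫
          ≤ ⟪W 0 j r, ξ i⟫ + 8 * n * Real.sqrt (Real.log (4 * n ^ 2 / δ) / d) * α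
            - η * ∑ s ∈ Finset.Icc 1 t, ⟪z s, ξ i⟫) ∧
      Fout q m (W t) j (y i • v) (ξ i) ≤ 1 := by
  intro j r i hij
  have hv2 : ‖v‖ ^ 2 ≠ 0 := by simpa using hv
  have signal : ∀ r, ⟪W t j r, y i • v⟫
      ≤ ⟪W 0 j r, y i • v⟫ - η * ∑ s ∈ Finset.Icc 1 t, ⟪z s, y i • v⟫ := by
    intro r
    have hyj := mul_jsgn_of_ne (hy i) hij
    have hΓ := (hΓα j r).1
    rw [hdecomp j r]
    simp only [inner_sub_left, inner_add_left, sum_inner, real_inner_smul_left,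
      real_inner_smul_right, horth, real_inner_self_eq_norm_sq, mul_zero, Finset.sum_const_zero,
      ← Finset.mul_sum]
    have : y i * (jsgn j * Γ j r / ‖v‖ ^ 2 * ‖v‖ ^ 2) = -Γ j r := by
      rw [show -Γ j r = (y i * jsgn j) * Γ j r by rw [hyj]; ring]
      field_simp
    linarith
  have noise : ∀ r, ⟪W t j r, ξ i⟫
      ≤ ⟪W 0 j r, ξ i⟫ + 8 * n * Real.sqrt (Real.log (4 * n ^ 2 / δ) / d) * α
        - η * ∑ s ∈ Finset.Icc 1 t, ⟪z s, ξ i⟫ := by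
    intro r
    have hd' : (0 : ℝ) < d := Nat.cast_pos.mpr hd
    have hsum := sum_div_mul_inner_le ξ i (fun k => Φb j r k + Φu j r k) hα
      (K := 4 * √(Real.log (4 * n ^ 2 / δ) / d)) (by positivity)
      (fun k => abs_le.mpr ⟨by linarith [(hΦb j r k).1, hΦuα j r k],
        by linarith [hΦbα j r k, (hΦu j r k).1]⟩)
      (by linarith [(hΦb j r i).2 hij, (hΦu j r i).1])
      (fun k hk => cross_div_norm_sq_le hσξ hd' (hnorm k) (hcross i k hk.symm))
    have hpos : 0 ≤ n * √(Real.log (4 * n ^ 2 / δ) / d) * α := by positivity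
    have hvξ : ⟪v, ξ i⟫ = 0 := by rw [real_inner_comm]; exact horth i
    rw [hdecomp j r]
    simp only [inner_sub_left, inner_add_left, sum_inner, real_inner_smul_left, hvξ, mul_zero]
    linarith
  refine ⟨signal r, noise r, ?_⟩
  have hβ := (mul_le_mul_of_nonneg_left (le_max_left _ _) zero_le_four).trans hsmall
  have hrest := (mul_le_mul_of_nonneg_left (le_max_right _ _) zero_le_four).trans hsmall
  have hcorr := (mul_le_mul_of_nonneg_left (le_max_left _ _) zero_le_four).trans hrest
  have hpriv := (mul_le_mul_of_nonneg_left (le_max_right _ _) zero_le_four).trans hrest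
  have hinit := fun r => le_iSup₃_of_finite
    (fun (j : Fin 2) (r : Fin m) (i : Fin n) => max |⟪W 0 j r, v⟫| |⟪W 0 j r, ξ i⟫|) j r i
  refine Fout_le_one hq hm (W t) j _ _ (fun r => (signal r).trans ?_)
    (fun r => (noise r).trans ?_)
  · have h0 := abs_le.mp ((le_max_left _ _).trans (hinit r))
    have hz := abs_le.mp hzv
    simp only [real_inner_smul_right, ← Finset.mul_sum]
    rcases hy i with h | h <;> rw [h] <;> linarith [h0.1, h0.2, hz.1, hz.2]
  · have h0 := (le_abs_self _).trans ((le_max_right _ _).trans (hinit r))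
    linarith [(abs_le.mp (hzξ i)).1]
end
end
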